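/- Let 1 ≤ p < ∞ and t ∈ [0,1). The point spectrum of C_t acting on H^p equals {1/(m+1) : m ∈ ℕ₀}, and the spectrum of C_t acting on H^p equals {1/(m+1) : m ∈ ℕ₀} ∪ {0}. -/

import Mathlib

open Complex MeasureTheory Metric Set Filter Topology

/-- The generalized Cesàro operator `C_t`, given by
`(C_t f)(z) = ∫_0^1 f(sz)/(1 - s t z) ds`, which equals `f(0)` at `z = 0` and
`(1/z)∫_0^z f(ξ)/(1 - tξ) dξ` for `z ≠ 0`. -/
noncomputable def cesaro (t : ℝ) (f : ℂ → ℂ) (z : ℂ) : ℂ :=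
  ∫ s in (0:ℝ)..1, f ((s : ℂ) * z) / (1 - (s : ℂ) * (t : ℂ) * z)

/-- The integral means `M_p(r, f)`. -/
noncomputable def Mp (p : ℝ) (r : ℝ) (f : ℂ → ℂ) : ℝ :=
  ((1 / (2 * Real.pi)) *
    ∫ θ in (0:ℝ)..(2 * Real.pi), ‖f ((r : ℂ) * Complex.exp ((θ : ℂ) * Complex.I))‖ ^ p) ^ (1 / p)

/-- The Hardy space norm `‖f‖_p = sup_{0 ≤ r < 1} M_p(r, f)`. -/
noncomputable def hardyNorm (p : ℝ) (f : ℂ → ℂ) : ℝ :=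
  sSup ((fun r => Mp p r f) '' Set.Ico (0:ℝ) 1)

/-- Membership in the Hardy space `H^p`: holomorphic on the unit disc with bounded
integral means. -/
def MemHp (p : ℝ) (f : ℂ → ℂ) : Prop :=
  DifferentiableOn ℂ f (Metric.ball (0:ℂ) 1) ∧
    BddAbove ((fun r => Mp p r f) '' Set.Ico (0:ℝ) 1)

/-- `λ` is in the resolvent set of the operator `T` acting on the space
`X = {f : Mem f}` with norm `N`: the operator `λI - T` maps `X` into `X`, is
surjective onto `X` (modulo equality on the disc) and has a continuous (linear)
inverse, i.e. it is bounded below. -/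
def IsResolventPt (Mem : (ℂ → ℂ) → Prop) (N : (ℂ → ℂ) → ℝ)
    (T : (ℂ → ℂ) → ℂ → ℂ) (lam : ℂ) : Prop :=
  (∀ f, Mem f → Mem (fun z => lam * f z - T f z)) ∧
  (∀ g, Mem g → ∃ f, Mem f ∧ Set.EqOn (fun z => lam * f z - T f z) g (Metric.ball (0:ℂ) 1)) ∧
  (∃ C : ℝ, ∀ f, Mem f → N f ≤ C * N (fun z => lam * f z - T f z))

/-- `f` is holomorphic on the unit disc and its unnormalized `p`-th power integral means are
at most `A`. -/
def HpBound (p : ℝ) (f : ℂ → ℂ) (A : ℝ) : Prop :=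
  DifferentiableOn ℂ f (ball (0:ℂ) 1) ∧
    ∀ r ∈ Ico (0:ℝ) 1,
      ∫ θ in (0:ℝ)..(2 * Real.pi), ‖f ((r : ℂ) * exp ((θ : ℂ) * I))‖ ^ p ≤ A

lemma circle_mem_ball {r : ℝ} (hr : r ∈ Ico (0:ℝ) 1) (θ : ℝ) :
    (r : ℂ) * exp ((θ : ℂ) * I) ∈ ball (0:ℂ) 1 := by
  simpa [norm_exp_ofReal_mul_I, abs_of_nonneg hr.1] using hr.2

lemma smul_mem_unitBall {s : ℝ} (hs : s ∈ Icc (0:ℝ) 1) {z : ℂ} (hz : z ∈ ball (0:ℂ) 1) :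
    (s : ℂ) * z ∈ ball (0:ℂ) 1 := by
  simp only [mem_ball_zero_iff, norm_mul, norm_real, Real.norm_eq_abs, abs_of_nonneg hs.1] at hz ⊢
  nlinarith [hs.1, hs.2, norm_nonneg z]

lemma continuous_on_circle {f : ℂ → ℂ} (hf : DifferentiableOn ℂ f (ball (0:ℂ) 1)) {r : ℝ}
    (hr : r ∈ Ico (0:ℝ) 1) : Continuous fun θ : ℝ => f ((r : ℂ) * exp ((θ : ℂ) * I)) :=
  hf.continuousOn.comp_continuous (by fun_prop) (circle_mem_ball hr)

lemma continuous_rpow_on_circle {p : ℝ} (hp : 1 ≤ p) {f : ℂ → ℂ}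
    (hf : DifferentiableOn ℂ f (ball (0:ℂ) 1)) {r : ℝ} (hr : r ∈ Ico (0:ℝ) 1) :
    Continuous fun θ : ℝ => ‖f ((r : ℂ) * exp ((θ : ℂ) * I))‖ ^ p :=
  (continuous_on_circle hf hr).norm.rpow_const fun _ => Or.inr (by linarith)

lemma integral_rpow_nonneg (p r : ℝ) (f : ℂ → ℂ) :
    0 ≤ ∫ θ in (0:ℝ)..(2 * Real.pi), ‖f ((r : ℂ) * exp ((θ : ℂ) * I))‖ ^ p :=
  intervalIntegral.integral_nonneg (by positivity) fun _ _ => by positivity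

lemma HpBound.nonneg {p A : ℝ} {f : ℂ → ℂ} (h : HpBound p f A) : 0 ≤ A :=
  (integral_rpow_nonneg p 0 f).trans (h.2 0 (by simp))

lemma HpBound.of_norm_rpow_le {p : ℝ} (hp : 1 ≤ p) {f g h : ℂ → ℂ} {A B c₀ c₁ c₂ : ℝ}
    (hf : DifferentiableOn ℂ f (ball (0:ℂ) 1)) (hg : HpBound p g A) (hh : HpBound p h B)
    (hc₁ : 0 ≤ c₁) (hc₂ : 0 ≤ c₂)
    (hle : ∀ z ∈ ball (0:ℂ) 1, ‖f z‖ ^ p ≤ c₀ + c₁ * ‖g z‖ ^ p + c₂ * ‖h z‖ ^ p) :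
    HpBound p f (2 * Real.pi * c₀ + c₁ * A + c₂ * B) := by
  refine ⟨hf, fun r hr => ?_⟩
  have ig := (continuous_rpow_on_circle hp hg.1 hr).intervalIntegrable (μ := volume)
    0 (2 * Real.pi)
  have ih := (continuous_rpow_on_circle hp hh.1 hr).intervalIntegrable (μ := volume)
    0 (2 * Real.pi)
  have i0 : IntervalIntegrable (fun _ : ℝ => c₀) volume 0 (2 * Real.pi) := by simp
  calc _ ≤ ∫ θ in (0:ℝ)..(2 * Real.pi), (c₀ + c₁ * ‖g ((r : ℂ) * exp ((θ : ℂ) * I))‖ ^ p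
        + c₂ * ‖h ((r : ℂ) * exp ((θ : ℂ) * I))‖ ^ p) :=
        intervalIntegral.integral_mono_on (by positivity)
          ((continuous_rpow_on_circle hp hf hr).intervalIntegrable _ _)
          ((i0.add (ig.const_mul c₁)).add (ih.const_mul c₂))
          fun θ _ => hle _ (circle_mem_ball hr θ)
    _ = 2 * Real.pi * c₀ + c₁ * (∫ θ in (0:ℝ)..(2 * Real.pi), ‖g (r * exp (θ * I))‖ ^ p)
        + c₂ * (∫ θ in (0:ℝ)..(2 * Real.pi), ‖h (r * exp (θ * I))‖ ^ p) := by
        rw [intervalIntegral.integral_add (i0.add (ig.const_mul c₁)) (ih.const_mul c₂),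
          intervalIntegral.integral_add i0 (ig.const_mul c₁)]
        simp
    _ ≤ _ := by
        have := mul_le_mul_of_nonneg_left (hg.2 r hr) hc₁
        have := mul_le_mul_of_nonneg_left (hh.2 r hr) hc₂
        linarith

lemma hpBound_zero {p : ℝ} (hp : 1 ≤ p) : HpBound p 0 0 :=
  ⟨differentiableOn_const 0, fun r _ => by simp [Real.zero_rpow (by linarith : p ≠ 0)]⟩

lemma HpBound.mono {p A B : ℝ} {f : ℂ → ℂ} (h : HpBound p f A) (hAB : A ≤ B) : HpBound p f B :=
  ⟨h.1, fun r hr => (h.2 r hr).trans hAB⟩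

lemma hpBound_of_norm_le {p : ℝ} (hp : 1 ≤ p) {f : ℂ → ℂ} {M : ℝ}
    (hf : DifferentiableOn ℂ f (ball (0:ℂ) 1)) (hle : ∀ z ∈ ball (0:ℂ) 1, ‖f z‖ ≤ M) :
    HpBound p f (2 * Real.pi * M ^ p) := by
  have := HpBound.of_norm_rpow_le hp hf (hpBound_zero hp) (hpBound_zero hp) le_rfl le_rfl
    (c₀ := M ^ p) fun z hz => by
      simpa using Real.rpow_le_rpow (norm_nonneg _) (hle z hz) (by linarith)
  simpa using this

lemma add_rpow_le {p : ℝ} (hp : 1 ≤ p) {a b : ℝ} (ha : 0 ≤ a) (hb : 0 ≤ b) :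
    (a + b) ^ p ≤ 2 ^ (p - 1) * (a ^ p + b ^ p) := by
  lift a to NNReal using ha
  lift b to NNReal using hb
  exact_mod_cast NNReal.rpow_add_le_mul_rpow_add_rpow a b hp

lemma HpBound.add {p : ℝ} (hp : 1 ≤ p) {f g : ℂ → ℂ} {A B : ℝ} (hf : HpBound p f A)
    (hg : HpBound p g B) : HpBound p (fun z => f z + g z) (2 ^ (p - 1) * (A + B)) := by
  have := HpBound.of_norm_rpow_le hp (hf.1.add hg.1) hf hg (c₀ := 0) (c₁ := 2 ^ (p - 1))
    (c₂ := 2 ^ (p - 1)) (by positivity) (by positivity) fun z _ => by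
      refine (Real.rpow_le_rpow (norm_nonneg _) (norm_add_le _ _) (by linarith)).trans
        ((add_rpow_le hp (norm_nonneg _) (norm_nonneg _)).trans_eq ?_)
      ring
  exact this.mono (by linarith)

lemma HpBound.mul {p : ℝ} (hp : 1 ≤ p) {f g : ℂ → ℂ} {A M : ℝ} (hf : HpBound p f A)
    (hg : DifferentiableOn ℂ g (ball (0:ℂ) 1)) (hM : 0 ≤ M)
    (hle : ∀ z ∈ ball (0:ℂ) 1, ‖g z‖ ≤ M) :
    HpBound p (fun z => g z * f z) (M ^ p * A) := by
  have := HpBound.of_norm_rpow_le hp (hg.mul hf.1) hf (hpBound_zero hp) (c₀ := 0) (c₁ := M ^ p)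
    (by positivity) le_rfl fun z hz => by
      simp only [Pi.mul_apply, norm_mul, zero_add, zero_mul, add_zero]
      rw [Real.mul_rpow (norm_nonneg _) (norm_nonneg _)]
      exact mul_le_mul_of_nonneg_right
        (Real.rpow_le_rpow (norm_nonneg _) (hle z hz) (by linarith)) (by positivity)
  exact this.mono (by simp)

lemma HpBound.const_mul {p : ℝ} (hp : 1 ≤ p) {f : ℂ → ℂ} {A : ℝ} (hf : HpBound p f A) (c : ℂ) :
    HpBound p (fun z => c * f z) (‖c‖ ^ p * A) :=
  hf.mul hp (differentiableOn_const c) (norm_nonneg c) fun _ _ => le_rfl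

lemma Mp_nonneg (p r : ℝ) (f : ℂ → ℂ) : 0 ≤ Mp p r f :=
  Real.rpow_nonneg (mul_nonneg (by positivity) (integral_rpow_nonneg p r f)) _

lemma hardyNorm_nonneg (p : ℝ) (f : ℂ → ℂ) : 0 ≤ hardyNorm p f := by
  refine Real.sSup_nonneg ?_
  rintro _ ⟨r, _, rfl⟩
  exact Mp_nonneg p r f

lemma MemHp.hpBound {p : ℝ} (hp : 1 ≤ p) {f : ℂ → ℂ} (h : MemHp p f) :
    HpBound p f (2 * Real.pi * hardyNorm p f ^ p) := by
  refine ⟨h.1, fun r hr => ?_⟩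
  have h1 : Mp p r f ≤ hardyNorm p f := le_csSup h.2 ⟨r, hr, rfl⟩
  have h2 := Real.rpow_le_rpow (Mp_nonneg p r f) h1 (by linarith : 0 ≤ p)
  rw [Mp, one_div p, Real.rpow_inv_rpow (mul_nonneg (by positivity) (integral_rpow_nonneg p r f))
    (by linarith), one_div, inv_mul_le_iff₀ (by positivity)] at h2
  exact h2

lemma HpBound.Mp_le {p A r : ℝ} (hp : 1 ≤ p) {f : ℂ → ℂ} (h : HpBound p f A)
    (hr : r ∈ Ico (0:ℝ) 1) : Mp p r f ≤ (1 / (2 * Real.pi) * A) ^ (1 / p) :=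
  Real.rpow_le_rpow (mul_nonneg (by positivity) (integral_rpow_nonneg p r f))
    (mul_le_mul_of_nonneg_left (h.2 r hr) (by positivity)) (by positivity)

lemma HpBound.memHp {p A : ℝ} (hp : 1 ≤ p) {f : ℂ → ℂ} (h : HpBound p f A) : MemHp p f := by
  refine ⟨h.1, (1 / (2 * Real.pi) * A) ^ (1 / p), ?_⟩
  rintro _ ⟨r, hr, rfl⟩
  exact h.Mp_le hp hr

lemma HpBound.hardyNorm_le {p A : ℝ} (hp : 1 ≤ p) {f : ℂ → ℂ} (h : HpBound p f A) :
    hardyNorm p f ≤ (1 / (2 * Real.pi) * A) ^ (1 / p) := by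
  refine csSup_le (Set.Nonempty.image _ ⟨0, by simp⟩) ?_
  rintro _ ⟨r, hr, rfl⟩
  exact h.Mp_le hp hr

lemma hardyNorm_congr {p : ℝ} {f g : ℂ → ℂ} (h : EqOn f g (ball (0:ℂ) 1)) :
    hardyNorm p f = hardyNorm p g := by
  refine congrArg sSup (image_congr fun r hr => ?_)
  simp only [Mp, h (circle_mem_ball hr _)]

/-- Jensen's inequality for `x ↦ x ^ p` on an interval. -/
lemma integral_rpow_le {p a b : ℝ} (hp : 1 ≤ p) (hab : a < b) {φ : ℝ → ℝ}
    (hφ : ContinuousOn φ (Icc a b)) (h0 : ∀ x ∈ Icc a b, 0 ≤ φ x) :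
    (∫ x in a..b, φ x) ^ p ≤ (b - a) ^ (p - 1) * ∫ x in a..b, φ x ^ p := by
  have hba : 0 < b - a := sub_pos.2 hab
  have hφp : ContinuousOn (fun x => φ x ^ p) (Icc a b) :=
    hφ.rpow_const fun _ _ => Or.inr (by linarith)
  have key := (convexOn_rpow hp).map_set_average_le (μ := volume) (t := Ioc a b) (f := φ)
    (Real.continuous_rpow_const (by linarith)).continuousOn isClosed_Ici (by simp [hab]) (by simp)
    (ae_restrict_of_forall_mem measurableSet_Ioc fun x hx => h0 x (Ioc_subset_Icc_self hx))
    (hφ.integrableOn_Icc.mono_set Ioc_subset_Icc_self)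
    (hφp.integrableOn_Icc.mono_set Ioc_subset_Icc_self)
  rw [setAverage_eq, setAverage_eq, ← intervalIntegral.integral_of_le hab.le,
    ← intervalIntegral.integral_of_le hab.le] at key
  simp only [smul_eq_mul, Real.volume_real_Ioc_of_le hab.le] at key
  rw [Real.mul_rpow (by positivity)
    (intervalIntegral.integral_nonneg hab.le h0), Real.inv_rpow hba.le,
    inv_mul_le_iff₀ (by positivity)] at key
  refine key.trans_eq ?_
  rw [Real.rpow_sub_one hba.ne']
  ring

lemma exists_norm_rpow_le {p ρ : ℝ} (hp : 1 ≤ p) (hρ0 : 0 ≤ ρ) (hρ : ρ < 1) :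
    ∃ C : ℝ, 0 ≤ C ∧ ∀ (f : ℂ → ℂ) (A : ℝ), HpBound p f A →
      ∀ z : ℂ, ‖z‖ ≤ ρ → ‖f z‖ ^ p ≤ C * A := by
  set R := (1 + ρ) / 2 with hR
  have hRρ : 0 < R - ρ := by linarith
  have hR0 : 0 < R := by linarith
  have hR1 : R < 1 := by linarith
  set K := (2 * Real.pi)⁻¹ * (R * (R - ρ)⁻¹) with hK
  have hK0 : 0 ≤ K := by positivity
  refine ⟨K ^ p * (2 * Real.pi) ^ (p - 1), by positivity, fun f A hf z hz => ?_⟩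
  have hRI : R ∈ Ico (0:ℝ) 1 := ⟨hR0.le, hR1⟩
  have hcont := (continuous_on_circle hf.1 hRI).norm
  have hzR : z ∈ ball (0:ℂ) R := by simpa using by linarith
  have hd : DiffContOnCl ℂ f (ball 0 R) :=
    (hf.1.mono ((closure_ball (0:ℂ) hR0.ne').subset.trans
      (closedBall_subset_ball hR1))).diffContOnCl
  have hint : ‖∮ ζ in C((0:ℂ), R), (ζ - z)⁻¹ • f ζ‖ ≤
      ∫ θ in (0:ℝ)..(2 * Real.pi), R * (R - ρ)⁻¹ * ‖f ((R : ℂ) * exp ((θ : ℂ) * I))‖ := by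
    refine intervalIntegral.norm_integral_le_of_norm_le (by positivity)
      (Eventually.of_forall fun θ _ => ?_) ((hcont.const_mul _).intervalIntegrable _ _)
    have h1 : R - ρ ≤ ‖circleMap 0 R θ - z‖ := by
      refine le_trans ?_ (norm_sub_norm_le _ _)
      simp only [norm_circleMap_zero, abs_of_pos hR0]
      linarith
    rw [deriv_circleMap, norm_smul, norm_smul, norm_mul, norm_circleMap_zero, norm_I, mul_one,
      abs_of_pos hR0, norm_inv, circleMap_zero, ← mul_assoc]
    rw [circleMap_zero] at h1
    gcongr
  rw [hd.circleIntegral_sub_inv_smul hzR, norm_smul, intervalIntegral.integral_const_mul] at hint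
  have hle : ‖f z‖ ≤ K * ∫ θ in (0:ℝ)..(2 * Real.pi), ‖f ((R : ℂ) * exp ((θ : ℂ) * I))‖ := by
    rw [hK, mul_assoc, le_inv_mul_iff₀ (by positivity)]
    simpa [abs_of_pos Real.pi_pos] using hint
  have hJ := integral_rpow_le hp (by positivity : (0:ℝ) < 2 * Real.pi) hcont.continuousOn
    fun _ _ => norm_nonneg _
  rw [sub_zero] at hJ
  calc ‖f z‖ ^ p ≤ (K * ∫ θ in (0:ℝ)..(2 * Real.pi), ‖f ((R : ℂ) * exp ((θ : ℂ) * I))‖) ^ p :=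
        Real.rpow_le_rpow (norm_nonneg _) hle (by linarith)
    _ = K ^ p * (∫ θ in (0:ℝ)..(2 * Real.pi), ‖f ((R : ℂ) * exp ((θ : ℂ) * I))‖) ^ p :=
        Real.mul_rpow hK0 (intervalIntegral.integral_nonneg (by positivity)
          fun _ _ => norm_nonneg _)
    _ ≤ K ^ p * ((2 * Real.pi) ^ (p - 1) * A) := by
        gcongr
        exact hJ.trans (by gcongr; exact hf.2 R hRI)
    _ = _ := by ring

lemma exists_hpBound_dslope {p : ℝ} (hp : 1 ≤ p) :
    ∃ C : ℝ, 0 ≤ C ∧ ∀ (f : ℂ → ℂ) (A : ℝ), HpBound p f A → HpBound p (dslope f 0) (C * A) := by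
  obtain ⟨C, hC0, hC⟩ := exists_norm_rpow_le hp (by norm_num : (0:ℝ) ≤ 1 / 2) (by norm_num)
  refine ⟨2 * Real.pi * (2 ^ (p - 1) * 4 ^ p * C) + 2 ^ (p - 1) * 2 ^ p, by positivity,
    fun f A hf => ?_⟩
  have hp0 : 0 < p := by linarith
  have hCA : 0 ≤ C * A := mul_nonneg hC0 hf.nonneg
  set M := (C * A) ^ p⁻¹ with hM
  have hM0 : 0 ≤ M := by positivity
  have hMp : M ^ p = C * A := Real.rpow_inv_rpow hCA hp0.ne'
  have hfM : ∀ z : ℂ, ‖z‖ ≤ 1 / 2 → ‖f z‖ ≤ M := fun z hz => by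
    rw [← Real.rpow_le_rpow_iff (norm_nonneg _) hM0 hp0, hMp]
    exact hC f A hf z hz
  have hf0 : ‖f 0‖ ≤ M := hfM 0 (by simp)
  have hd : DifferentiableOn ℂ (dslope f 0) (ball (0:ℂ) 1) :=
    (differentiableOn_dslope (ball_mem_nhds 0 one_pos)).2 hf.1
  have hpt : ∀ z ∈ ball (0:ℂ) 1, ‖dslope f 0 z‖ ≤ 4 * M + 2 * ‖f z‖ := by
    intro z hz
    rcases lt_or_ge ‖z‖ (1 / 2) with h | h
    · have h1 := norm_dslope_le_div_of_mapsTo_ball (f := f) (c := 0) (R₁ := 1 / 2) (R₂ := 2 * M)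
        (z := z) (hf.1.mono (ball_subset_ball (by norm_num))) (fun w hw => by
          rw [mem_closedBall, dist_eq_norm]
          have := hfM w (by simpa using (mem_ball_zero_iff.1 hw).le)
          linarith [norm_sub_le (f w) (f 0)]) (by simpa using h)
      linarith [norm_nonneg (f z)]
    · have hz0 : z ≠ 0 := by
        rintro rfl
        norm_num at h
      have hzi : ‖z‖⁻¹ ≤ 2 := by
        rw [inv_le_comm₀ (by linarith) two_pos]
        linarith
      rw [dslope_of_ne _ hz0, slope_def_module, sub_zero, norm_smul, norm_inv]
      calc ‖z‖⁻¹ * ‖f z - f 0‖ ≤ 2 * (‖f z‖ + ‖f 0‖) :=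
            mul_le_mul hzi (norm_sub_le _ _) (norm_nonneg _) (by norm_num)
        _ ≤ _ := by linarith
  have := HpBound.of_norm_rpow_le hp hd hf (hpBound_zero hp)
    (c₀ := 2 ^ (p - 1) * (4 ^ p * (C * A))) (c₁ := 2 ^ (p - 1) * 2 ^ p) (c₂ := 0)
    (by positivity) le_rfl fun z hz => by
      refine (Real.rpow_le_rpow (norm_nonneg _) (hpt z hz) hp0.le).trans
        ((add_rpow_le hp (by positivity) (by positivity)).trans_eq ?_)
      rw [Real.mul_rpow (by norm_num) hM0, Real.mul_rpow (by norm_num) (norm_nonneg _), hMp]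
      ring
  exact this.mono (le_of_eq (by ring))

/-- The averaging operator `v ↦ ∫₀¹ s ^ (b - 1) v(sz) ds`, an inverse of `b + z d/dz`. -/
noncomputable def eulerIntegral (b : ℂ) (v : ℂ → ℂ) (z : ℂ) : ℂ :=
  ∫ s in (0:ℝ)..1, (s : ℂ) ^ (b - 1) * v ((s : ℂ) * z)

lemma norm_ofReal_cpow_le_one {b : ℂ} (hb : 1 ≤ b.re) {s : ℝ} (hs : s ∈ Ioc (0:ℝ) 1) :
    ‖(s : ℂ) ^ (b - 1)‖ ≤ 1 := by
  rw [norm_cpow_eq_rpow_re_of_pos hs.1]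
  exact Real.rpow_le_one hs.1.le hs.2 (by simpa using hb)

lemma continuousOn_comp_ofReal_mul {v : ℂ → ℂ} (hv : ContinuousOn v (ball (0:ℂ) 1))
    {z : ℂ} (hz : z ∈ ball (0:ℂ) 1) :
    ContinuousOn (fun s : ℝ => v ((s : ℂ) * z)) (Icc 0 1) :=
  hv.comp (by fun_prop) fun _ hs => smul_mem_unitBall hs hz

lemma continuousOn_ofReal_mul_comp {v : ℂ → ℂ} (hv : ContinuousOn v (ball (0:ℂ) 1))
    {z : ℂ} (hz : z ∈ ball (0:ℂ) 1) :
    ContinuousOn (fun s : ℝ => (s : ℂ) * v ((s : ℂ) * z)) (Icc 0 1) :=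
  continuous_ofReal.continuousOn.mul (continuousOn_comp_ofReal_mul hv hz)

lemma intervalIntegrable_cpow_mul {b : ℂ} (hb : 1 ≤ b.re) {φ : ℝ → ℂ}
    (hφ : ContinuousOn φ (Icc 0 1)) :
    IntervalIntegrable (fun s : ℝ => (s : ℂ) ^ (b - 1) * φ s) volume 0 1 :=
  (intervalIntegral.intervalIntegrable_cpow' (by simp; linarith)).mul_continuousOn
    (by rwa [uIcc_of_le zero_le_one])

lemma norm_eulerIntegral_le {b : ℂ} (hb : 1 ≤ b.re) {v : ℂ → ℂ}
    (hv : ContinuousOn v (ball (0:ℂ) 1)) {z : ℂ} (hz : z ∈ ball (0:ℂ) 1) :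
    ‖eulerIntegral b v z‖ ≤ ∫ s in (0:ℝ)..1, ‖v ((s : ℂ) * z)‖ := by
  refine intervalIntegral.norm_integral_le_of_norm_le zero_le_one
    (Eventually.of_forall fun s hs => ?_)
    ((continuousOn_comp_ofReal_mul hv hz).norm.intervalIntegrable_of_Icc zero_le_one)
  rw [norm_mul]
  exact mul_le_of_le_one_left (norm_nonneg _) (norm_ofReal_cpow_le_one hb hs)

lemma hasDerivAt_eulerIntegral {b : ℂ} (hb : 1 ≤ b.re) {v : ℂ → ℂ}
    (hv : DifferentiableOn ℂ v (ball (0:ℂ) 1)) {z : ℂ} (hz : z ∈ ball (0:ℂ) 1) :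
    HasDerivAt (eulerIntegral b v)
      (∫ s in (0:ℝ)..1, (s : ℂ) ^ (b - 1) * (s * deriv v ((s : ℂ) * z))) z := by
  have hd : ContinuousOn (deriv v) (ball (0:ℂ) 1) := (hv.deriv isOpen_ball).continuousOn
  rw [mem_ball_zero_iff] at hz
  obtain ⟨ρ, hzρ, hρ⟩ := exists_between hz
  have hsub : closedBall (0:ℂ) ρ ⊆ ball 0 1 := closedBall_subset_ball hρ
  obtain ⟨M, hM⟩ := (isCompact_closedBall (0:ℂ) ρ).exists_bound_of_continuousOn (hd.mono hsub)
  have hmem : ∀ x ∈ ball (0:ℂ) ρ, ∀ s ∈ Ioc (0:ℝ) 1, (s : ℂ) * x ∈ closedBall (0:ℂ) ρ := by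
    intro x hx s hs
    rw [mem_ball_zero_iff] at hx
    rw [mem_closedBall_zero_iff, norm_mul, norm_real, Real.norm_eq_abs, abs_of_pos hs.1]
    nlinarith [hs.1, hs.2, norm_nonneg x]
  have hnhds : ball (0:ℂ) ρ ∈ 𝓝 z := isOpen_ball.mem_nhds (by simpa using hzρ)
  have hball : ∀ x ∈ ball (0:ℂ) ρ, x ∈ ball (0:ℂ) 1 := fun x hx =>
    hsub (ball_subset_closedBall hx)
  refine (intervalIntegral.hasDerivAt_integral_of_dominated_loc_of_deriv_le (μ := volume)
    (s := ball (0:ℂ) ρ) (bound := fun _ => M)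
    (F := fun z s => (s : ℂ) ^ (b - 1) * v ((s : ℂ) * z))
    (F' := fun z s => (s : ℂ) ^ (b - 1) * (s * deriv v ((s : ℂ) * z)))
    hnhds ?_ ?_ ?_ ?_ (by simp) ?_).2
  · filter_upwards [hnhds] with x hx
    exact (intervalIntegrable_cpow_mul hb
      (continuousOn_comp_ofReal_mul hv.continuousOn (hball x hx))).aestronglyMeasurable_restrict_uIoc
  · exact intervalIntegrable_cpow_mul hb
      (continuousOn_comp_ofReal_mul hv.continuousOn (by simpa using hz))
  · exact (intervalIntegrable_cpow_mul hb
      (continuousOn_ofReal_mul_comp hd (by simpa using hz))).aestronglyMeasurable_restrict_uIoc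
  · refine Eventually.of_forall fun s hs x hx => ?_
    rw [uIoc_of_le zero_le_one] at hs
    have h1 := hM _ (hmem x hx s hs)
    rw [norm_mul, norm_mul, norm_real, Real.norm_eq_abs, abs_of_pos hs.1]
    refine (mul_le_of_le_one_left (mul_nonneg hs.1.le (norm_nonneg _))
      (norm_ofReal_cpow_le_one hb hs)).trans
      ((mul_le_of_le_one_left (norm_nonneg _) hs.2).trans h1)
  · refine Eventually.of_forall fun s hs x hx => ?_
    rw [uIoc_of_le zero_le_one] at hs
    have h1 : HasDerivAt v (deriv v ((s : ℂ) * x)) ((s : ℂ) * x) :=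
      (hv.differentiableAt (isOpen_ball.mem_nhds (hsub (hmem x hx s hs)))).hasDerivAt
    have h2 : HasDerivAt (fun y : ℂ => (s : ℂ) * y) (s : ℂ) x := by
      simpa using (hasDerivAt_id x).const_mul (s : ℂ)
    simpa [mul_comm] using (h1.comp x h2).const_mul ((s : ℂ) ^ (b - 1))

lemma eulerIntegral_equation {b : ℂ} (hb : 1 ≤ b.re) {v : ℂ → ℂ}
    (hv : DifferentiableOn ℂ v (ball (0:ℂ) 1)) {z : ℂ} (hz : z ∈ ball (0:ℂ) 1) :
    b * eulerIntegral b v z + z * deriv (eulerIntegral b v) z = v z := by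
  have hd : ContinuousOn (deriv v) (ball (0:ℂ) 1) := (hv.deriv isOpen_ball).continuousOn
  have hb0 : b ≠ 0 := by
    rintro rfl
    norm_num at hb
  have hi1 := (intervalIntegrable_cpow_mul hb
    (continuousOn_comp_ofReal_mul hv.continuousOn hz)).const_mul b
  have hi2 := (intervalIntegrable_cpow_mul hb
    (continuousOn_ofReal_mul_comp hd hz)).const_mul z
  have hftc := intervalIntegral.integral_eq_sub_of_hasDerivAt_of_le zero_le_one
    (f := fun s : ℝ => (s : ℂ) ^ b * v ((s : ℂ) * z))
    ((Complex.continuous_ofReal_cpow_const (by linarith)).continuousOn.mul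
      (continuousOn_comp_ofReal_mul hv.continuousOn hz)) (fun s hs => ?_) (hi1.add hi2)
  · rw [(hasDerivAt_eulerIntegral hb hv hz).deriv, eulerIntegral,
      ← intervalIntegral.integral_const_mul, ← intervalIntegral.integral_const_mul,
      ← intervalIntegral.integral_add hi1 hi2, hftc]
    simp [zero_cpow hb0]
  · have hs0 : (s : ℂ) ≠ 0 := ofReal_ne_zero.2 hs.1.ne'
    have h1 : HasDerivAt v (deriv v ((s : ℂ) * z)) ((s : ℂ) * z) :=
      (hv.differentiableAt (isOpen_ball.mem_nhds
        (smul_mem_unitBall (Ioo_subset_Icc_self hs) hz))).hasDerivAt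
    have h2 : HasDerivAt (fun y : ℝ => (y : ℂ) * z) z s := by
      simpa using (ofRealCLM.hasDerivAt (x := s)).mul_const z
    refine ((hasDerivAt_ofReal_cpow_const hs.1.ne' hb0).mul (h1.comp s h2)).congr_deriv ?_
    rw [show (s : ℂ) ^ b = (s : ℂ) ^ (b - 1) * s by
      rw [cpow_sub _ _ hs0, cpow_one, div_mul_cancel₀ _ hs0]]
    simp only [Function.comp]
    ring

lemma HpBound.eulerIntegral {p A : ℝ} (hp : 1 ≤ p) {b : ℂ} (hb : 1 ≤ b.re) {v : ℂ → ℂ}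
    (hv : HpBound p v A) : HpBound p (eulerIntegral b v) A := by
  have hdiff : DifferentiableOn ℂ (_root_.eulerIntegral b v) (ball (0:ℂ) 1) := fun z hz =>
    (hasDerivAt_eulerIntegral hb hv.1 hz).differentiableAt.differentiableWithinAt
  refine ⟨hdiff, fun r hr => ?_⟩
  have hrs : ∀ s ∈ Icc (0:ℝ) 1, s * r ∈ Ico (0:ℝ) 1 := fun s hs =>
    ⟨mul_nonneg hs.1 hr.1, by nlinarith [hs.1, hs.2, hr.1, hr.2]⟩
  set G : ℝ → ℝ → ℝ := fun θ s => ‖v ((s : ℂ) * (r * exp (θ * I)))‖ ^ p with hG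
  have hGc : ContinuousOn (Function.uncurry G) (Icc 0 (2 * Real.pi) ×ˢ Icc 0 1) := by
    refine ContinuousOn.rpow_const (ContinuousOn.norm ?_) fun _ _ => Or.inr (by linarith)
    exact hv.1.continuousOn.comp (by fun_prop) fun x hx =>
      smul_mem_unitBall hx.2 (circle_mem_ball hr _)
  have hGi : Integrable (Function.uncurry G)
      ((volume.restrict (Ioc 0 (2 * Real.pi))).prod (volume.restrict (Ioc (0:ℝ) 1))) := by
    rw [Measure.prod_restrict]
    exact (hGc.integrableOn_compact (isCompact_Icc.prod isCompact_Icc)).mono_set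
      (prod_mono Ioc_subset_Icc_self Ioc_subset_Icc_self)
  have hpi : (0:ℝ) ≤ 2 * Real.pi := by positivity
  calc _ ≤ ∫ θ in (0:ℝ)..(2 * Real.pi), ∫ s in (0:ℝ)..1, G θ s := by
        refine intervalIntegral.integral_mono_on hpi
          ((continuous_rpow_on_circle hp hdiff hr).intervalIntegrable _ _) ?_ fun θ _ => ?_
        · rw [intervalIntegrable_iff_integrableOn_Ioc_of_le hpi]
          simp only [intervalIntegral.integral_of_le zero_le_one]
          exact hGi.integral_prod_left
        · have hz := circle_mem_ball hr θ
          refine (Real.rpow_le_rpow (norm_nonneg _)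
            (norm_eulerIntegral_le hb hv.1.continuousOn hz) (by linarith)).trans ?_
          simpa using integral_rpow_le hp one_pos
            (continuousOn_comp_ofReal_mul hv.1.continuousOn hz).norm fun _ _ => norm_nonneg _
    _ = ∫ s in (0:ℝ)..1, ∫ θ in (0:ℝ)..(2 * Real.pi), G θ s := by
        simp only [intervalIntegral.integral_of_le zero_le_one,
          intervalIntegral.integral_of_le hpi]
        exact integral_integral_swap hGi
    _ ≤ ∫ _ in (0:ℝ)..1, A := by
        refine intervalIntegral.integral_mono_on zero_le_one ?_ (by simp) fun s hs => ?_
        · rw [intervalIntegrable_iff_integrableOn_Ioc_of_le zero_le_one]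
          simp only [intervalIntegral.integral_of_le hpi]
          exact hGi.integral_prod_right
        · simpa [hG, mul_assoc] using hv.2 _ (hrs s hs)
    _ = A := by simp

lemma exists_eq_neg_natCast_of_euler_eq_zero {b : ℂ} {u : ℂ → ℂ}
    (hu : DifferentiableOn ℂ u (ball (0:ℂ) 1))
    (heq : ∀ z ∈ ball (0:ℂ) 1, b * u z + z * deriv u z = 0)
    (hne : ∃ z ∈ ball (0:ℂ) 1, u z ≠ 0) : ∃ m : ℕ, b = -(m : ℂ) := by
  have h0 : (0:ℂ) ∈ ball (0:ℂ) 1 := mem_ball_self one_pos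
  have han : AnalyticOnNhd ℂ u (ball (0:ℂ) 1) := hu.analyticOnNhd isOpen_ball
  have hnot : ¬ ∀ᶠ z in 𝓝 (0:ℂ), u z = 0 := fun h => by
    obtain ⟨z, hz, hz'⟩ := hne
    exact hz' (han.eqOn_zero_of_preconnected_of_eventuallyEq_zero
      (convex_ball 0 1).isPreconnected h0 h hz)
  obtain ⟨m, g, hg, hg0, hug⟩ := (han 0 h0).exists_eventuallyEq_pow_smul_nonzero_iff.2 hnot
  simp only [sub_zero, smul_eq_mul] at hug
  have hev : ∀ᶠ z in 𝓝[≠] (0:ℂ), (b + m) * g z + z * deriv g z = 0 := by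
    filter_upwards [hug.eventually_nhds.filter_mono nhdsWithin_le_nhds,
      hg.eventually_analyticAt.filter_mono nhdsWithin_le_nhds,
      (isOpen_ball.mem_nhds h0 : ball (0:ℂ) 1 ∈ 𝓝 0) |> mem_nhdsWithin_of_mem_nhds,
      self_mem_nhdsWithin] with z hz hgz hzb hz0
    have hd : HasDerivAt u (m * z ^ (m - 1) * g z + z ^ m * deriv g z) z :=
      ((hasDerivAt_pow m z).mul hgz.differentiableAt.hasDerivAt).congr_of_eventuallyEq hz
    have h1 := heq z hzb
    rw [hd.deriv, hz.self_of_nhds] at h1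
    have h2 : z * (m * z ^ (m - 1)) = m * z ^ m := by
      cases m with
      | zero => simp
      | succ k => simp only [Nat.add_sub_cancel]; ring
    refine (mul_eq_zero.1 (?_ : z ^ m * _ = 0)).resolve_left (pow_ne_zero m hz0)
    linear_combination h1 - g z * h2
  have hcont : ContinuousAt (fun z => (b + m) * g z + z * deriv g z) 0 := by
    have := hg.continuousAt
    have := hg.deriv.continuousAt
    fun_prop
  have hlim := tendsto_nhds_unique (hcont.tendsto.mono_left nhdsWithin_le_nhds)
    ((tendsto_congr' (f₁ := fun z => (b + m) * g z + z * deriv g z) (f₂ := fun _ => (0:ℂ))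
      (l₁ := 𝓝[≠] (0:ℂ)) hev).2 tendsto_const_nhds)
  simp only [zero_mul, add_zero] at hlim
  exact ⟨m, eq_neg_of_add_eq_zero_left ((mul_eq_zero.1 hlim).resolve_right hg0)⟩

lemma exists_hpBound_euler_solution {p : ℝ} (hp : 1 ≤ p) {b : ℂ} (hb : ∀ m : ℕ, b ≠ -(m : ℂ)) :
    ∃ C : ℝ, 0 ≤ C ∧ ∀ (v : ℂ → ℂ) (A : ℝ), HpBound p v A →
      ∃ u, HpBound p u (C * A) ∧ ∀ z ∈ ball (0:ℂ) 1, b * u z + z * deriv u z = v z := by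
  obtain ⟨n, hn⟩ := exists_nat_ge (1 - b.re)
  induction n generalizing b with
  | zero =>
    have hb1 : 1 ≤ b.re := by
      simp only [Nat.cast_zero] at hn
      linarith
    exact ⟨1, zero_le_one, fun v A hv => ⟨eulerIntegral b v, by simpa using hv.eulerIntegral hp hb1,
      fun z hz => eulerIntegral_equation hb1 hv.1 hz⟩⟩
  | succ n ih =>
    have hb0 : b ≠ 0 := by simpa using hb 0
    obtain ⟨C₁, hC₁, h₁⟩ := ih (b := b + 1)
      (fun m hm => hb (m + 1) (by push_cast; linear_combination hm))
      (by simp only [add_re, one_re]; push_cast at hn; linarith)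
    obtain ⟨C₂, hC₂, h₂⟩ := exists_hpBound_dslope hp
    obtain ⟨C₃, hC₃, h₃⟩ := exists_norm_rpow_le hp le_rfl zero_lt_one
    refine ⟨2 ^ (p - 1) * (‖b⁻¹‖ ^ p * (2 * Real.pi * C₃) + 1 ^ p * (C₁ * C₂)), by positivity,
      fun v A hv => ?_⟩
    obtain ⟨w, hw, hweq⟩ := h₁ _ _ (h₂ v A hv)
    have hconst : HpBound p (fun _ => v 0) (2 * Real.pi * (C₃ * A)) :=
      (hpBound_of_norm_le hp (differentiableOn_const _) fun _ _ => le_rfl).mono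
        (by gcongr; exact h₃ v A hv 0 (by simp))
    have hzw : HpBound p (fun z => z * w z) (1 ^ p * (C₁ * (C₂ * A))) :=
      hw.mul hp differentiableOn_id zero_le_one fun z hz => (mem_ball_zero_iff.1 hz).le
    refine ⟨fun z => b⁻¹ * v 0 + z * w z,
      ((hconst.const_mul hp b⁻¹).add hp hzw).mono (le_of_eq (by ring)), fun z hz => ?_⟩
    have hd : HasDerivAt (fun z => b⁻¹ * v 0 + z * w z) (1 * w z + z * deriv w z) z :=
      ((hasDerivAt_id z).mul
        (hw.1.differentiableAt (isOpen_ball.mem_nhds hz)).hasDerivAt).const_add _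
    have h4 : z * dslope v 0 z = v z - v 0 := by
      simpa using sub_smul_dslope v 0 z
    rw [hd.deriv]
    linear_combination z * hweq z hz + h4 + v 0 * mul_inv_cancel₀ hb0

lemma one_sub_mul_mem_slitPlane {t : ℝ} (ht0 : 0 ≤ t) (ht1 : t < 1) {z : ℂ}
    (hz : z ∈ closedBall (0:ℂ) 1) : 1 - (t : ℂ) * z ∈ slitPlane := by
  refine Or.inl ?_
  rw [mem_closedBall_zero_iff] at hz
  have := re_le_norm z
  simp only [sub_re, one_re, re_ofReal_mul]
  nlinarith

lemma one_sub_mul_ne_zero {t : ℝ} (ht0 : 0 ≤ t) (ht1 : t < 1) {z : ℂ}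
    (hz : z ∈ ball (0:ℂ) 1) : 1 - (t : ℂ) * z ≠ 0 :=
  slitPlane_ne_zero (one_sub_mul_mem_slitPlane ht0 ht1 (ball_subset_closedBall hz))

lemma hasDerivAt_one_sub_cpow {t : ℝ} (ht0 : 0 ≤ t) (ht1 : t < 1) (a : ℂ) {z : ℂ}
    (hz : z ∈ closedBall (0:ℂ) 1) :
    HasDerivAt (fun z : ℂ => (1 - (t : ℂ) * z) ^ a)
      (-(a * t) * ((1 - (t : ℂ) * z) ^ a / (1 - (t : ℂ) * z))) z := by
  have hs := one_sub_mul_mem_slitPlane ht0 ht1 hz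
  have h1 : HasDerivAt (fun z : ℂ => 1 - (t : ℂ) * z) (-(t : ℂ)) z := by
    simpa using ((hasDerivAt_id z).const_mul (t : ℂ)).const_sub 1
  refine (h1.cpow_const hs).congr_deriv ?_
  rw [cpow_sub _ _ (slitPlane_ne_zero hs), cpow_one]
  ring

lemma differentiableOn_one_sub_cpow {t : ℝ} (ht0 : 0 ≤ t) (ht1 : t < 1) (a : ℂ) :
    DifferentiableOn ℂ (fun z : ℂ => (1 - (t : ℂ) * z) ^ a) (ball 0 1) := fun _ hz =>
  (hasDerivAt_one_sub_cpow ht0 ht1 a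
    (ball_subset_closedBall hz)).differentiableAt.differentiableWithinAt

lemma exists_norm_one_sub_cpow_le {t : ℝ} (ht0 : 0 ≤ t) (ht1 : t < 1) (a : ℂ) :
    ∃ M : ℝ, 0 ≤ M ∧ ∀ z ∈ ball (0:ℂ) 1, ‖(1 - (t : ℂ) * z) ^ a‖ ≤ M := by
  obtain ⟨M, hM⟩ := (isCompact_closedBall (0:ℂ) 1).exists_bound_of_continuousOn
    (f := fun z : ℂ => (1 - (t : ℂ) * z) ^ a) fun z hz =>
      (hasDerivAt_one_sub_cpow ht0 ht1 a hz).continuousAt.continuousWithinAt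
  exact ⟨M, (norm_nonneg _).trans (hM 0 (by simp)), fun z hz => hM z (ball_subset_closedBall hz)⟩

lemma exists_hpBound_one_sub_cpow_mul {p t : ℝ} (hp : 1 ≤ p) (ht0 : 0 ≤ t) (ht1 : t < 1) (a : ℂ) :
    ∃ C : ℝ, 0 ≤ C ∧ ∀ (f : ℂ → ℂ) (A : ℝ), HpBound p f A →
      HpBound p (fun z => (1 - (t : ℂ) * z) ^ a * f z) (C * A) := by
  obtain ⟨M, hM0, hM⟩ := exists_norm_one_sub_cpow_le ht0 ht1 a
  exact ⟨M ^ p, by positivity, fun f A hf =>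
    hf.mul hp (differentiableOn_one_sub_cpow ht0 ht1 a) hM0 hM⟩

lemma differentiableOn_div_one_sub {t : ℝ} (ht0 : 0 ≤ t) (ht1 : t < 1) {f : ℂ → ℂ}
    (hf : DifferentiableOn ℂ f (ball (0:ℂ) 1)) :
    DifferentiableOn ℂ (fun z => f z / (1 - (t : ℂ) * z)) (ball 0 1) :=
  hf.div (by fun_prop) fun _ hz => one_sub_mul_ne_zero ht0 ht1 hz

lemma cesaro_eq_eulerIntegral (t : ℝ) (f : ℂ → ℂ) :
    cesaro t f = eulerIntegral 1 fun z => f z / (1 - (t : ℂ) * z) := by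
  ext z
  simp only [cesaro, eulerIntegral, sub_self, cpow_zero, one_mul]
  congr! 4
  ring

lemma differentiableOn_cesaro {t : ℝ} (ht0 : 0 ≤ t) (ht1 : t < 1) {f : ℂ → ℂ}
    (hf : DifferentiableOn ℂ f (ball (0:ℂ) 1)) : DifferentiableOn ℂ (cesaro t f) (ball 0 1) := by
  rw [cesaro_eq_eulerIntegral]
  exact fun z hz => (hasDerivAt_eulerIntegral (by simp) (differentiableOn_div_one_sub ht0 ht1 hf)
    hz).differentiableAt.differentiableWithinAt

lemma cesaro_equation {t : ℝ} (ht0 : 0 ≤ t) (ht1 : t < 1) {f : ℂ → ℂ}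
    (hf : DifferentiableOn ℂ f (ball (0:ℂ) 1)) {z : ℂ} (hz : z ∈ ball (0:ℂ) 1) :
    cesaro t f z + z * deriv (cesaro t f) z = f z / (1 - (t : ℂ) * z) := by
  rw [cesaro_eq_eulerIntegral]
  simpa using eulerIntegral_equation (b := 1) (by simp)
    (differentiableOn_div_one_sub ht0 ht1 hf) hz

lemma exists_hpBound_cesaro {p t : ℝ} (hp : 1 ≤ p) (ht0 : 0 ≤ t) (ht1 : t < 1) :
    ∃ C : ℝ, 0 ≤ C ∧ ∀ (f : ℂ → ℂ) (A : ℝ), HpBound p f A → HpBound p (cesaro t f) (C * A) := by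
  obtain ⟨C, hC0, hC⟩ := exists_hpBound_one_sub_cpow_mul hp ht0 ht1 (-1)
  refine ⟨C, hC0, fun f A hf => ?_⟩
  rw [cesaro_eq_eulerIntegral]
  refine HpBound.eulerIntegral hp (by simp) ?_
  simpa [cpow_neg_one, div_eq_inv_mul] using hC f A hf

lemma cesaro_eqOn_of_equation {t : ℝ} (ht0 : 0 ≤ t) (ht1 : t < 1) {f K : ℂ → ℂ}
    (hf : DifferentiableOn ℂ f (ball (0:ℂ) 1)) (hK : DifferentiableOn ℂ K (ball (0:ℂ) 1))
    (heq : ∀ z ∈ ball (0:ℂ) 1, K z + z * deriv K z = f z / (1 - (t : ℂ) * z)) :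
    EqOn (cesaro t f) K (ball 0 1) := by
  have hc := differentiableOn_cesaro ht0 ht1 hf
  by_contra hne
  simp only [EqOn, not_forall, exists_prop] at hne
  obtain ⟨m, hm⟩ := exists_eq_neg_natCast_of_euler_eq_zero (b := 1) (hc.sub hK)
    (fun z hz => by
      have hn := isOpen_ball.mem_nhds hz
      rw [deriv_sub (hc.differentiableAt hn) (hK.differentiableAt hn)]
      simp only [Pi.sub_apply]
      linear_combination cesaro_equation ht0 ht1 hf hz - heq z hz)
    (by simpa [sub_eq_zero] using hne)
  have := congrArg re hm
  simp only [one_re, neg_re, natCast_re] at this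
  linarith [(Nat.cast_nonneg m : (0:ℝ) ≤ m)]

lemma cesaro_sub {t : ℝ} (ht0 : 0 ≤ t) (ht1 : t < 1) {f g : ℂ → ℂ}
    (hf : DifferentiableOn ℂ f (ball (0:ℂ) 1)) (hg : DifferentiableOn ℂ g (ball (0:ℂ) 1)) :
    EqOn (cesaro t fun z => f z - g z) (fun z => cesaro t f z - cesaro t g z) (ball 0 1) := by
  refine cesaro_eqOn_of_equation ht0 ht1 (hf.sub hg) ((differentiableOn_cesaro ht0 ht1 hf).sub
    (differentiableOn_cesaro ht0 ht1 hg)) fun z hz => ?_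
  have hn := isOpen_ball.mem_nhds hz
  rw [deriv_fun_sub ((differentiableOn_cesaro ht0 ht1 hf).differentiableAt hn)
    ((differentiableOn_cesaro ht0 ht1 hg).differentiableAt hn), sub_div]
  linear_combination cesaro_equation ht0 ht1 hf hz - cesaro_equation ht0 ht1 hg hz

lemma eq_one_div_of_cesaro_eigenvector {t : ℝ} (ht0 : 0 ≤ t) (ht1 : t < 1) {lam : ℂ} {f : ℂ → ℂ}
    (hf : DifferentiableOn ℂ f (ball (0:ℂ) 1)) (hne : ∃ z ∈ ball (0:ℂ) 1, f z ≠ 0)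
    (heq : EqOn (cesaro t f) (fun z => lam * f z) (ball 0 1)) :
    ∃ m : ℕ, lam = 1 / ((m : ℂ) + 1) := by
  have hode : ∀ z ∈ ball (0:ℂ) 1,
      lam * (f z + z * deriv f z) = f z / (1 - (t : ℂ) * z) := fun z hz => by
    have h := cesaro_equation ht0 ht1 hf hz
    rw [(heq.eventuallyEq_of_mem (isOpen_ball.mem_nhds hz)).deriv_eq, heq hz,
      deriv_const_mul _ (hf.differentiableAt (isOpen_ball.mem_nhds hz))] at h
    linear_combination h
  have hlam : lam ≠ 0 := by
    rintro rfl
    obtain ⟨z, hz, hz'⟩ := hne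
    have h := hode z hz
    rw [zero_mul] at h
    exact div_ne_zero hz' (one_sub_mul_ne_zero ht0 ht1 hz) h.symm
  obtain ⟨m, hm⟩ := exists_eq_neg_natCast_of_euler_eq_zero (b := 1 - lam⁻¹)
    (u := fun z => (1 - (t : ℂ) * z) ^ lam⁻¹ * f z)
    ((differentiableOn_one_sub_cpow ht0 ht1 _).mul hf) (fun z hz => by
      have hz0 := one_sub_mul_ne_zero ht0 ht1 hz
      rw [((hasDerivAt_one_sub_cpow ht0 ht1 lam⁻¹ (ball_subset_closedBall hz)).fun_mul
        (hf.differentiableAt (isOpen_ball.mem_nhds hz)).hasDerivAt).deriv]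
      have h := hode z hz
      generalize (1 - (t : ℂ) * z) ^ lam⁻¹ = w
      obtain ⟨d, hd⟩ : ∃ d, d = 1 - (t : ℂ) * z := ⟨_, rfl⟩
      rw [← hd] at h hz0 ⊢
      field_simp at h ⊢
      linear_combination w * h - w * f z * hd)
    (by
      obtain ⟨z, hz, hz'⟩ := hne
      exact ⟨z, hz, mul_ne_zero
        (cpow_ne_zero_iff_of_exponent_ne_zero (inv_ne_zero hlam) |>.2
          (one_sub_mul_ne_zero ht0 ht1 hz)) hz'⟩)
  refine ⟨m, ?_⟩
  rw [eq_div_iff (Nat.cast_add_one_ne_zero m)]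
  linear_combination lam * hm + mul_inv_cancel₀ hlam

lemma exists_hpBound_resolvent {p t : ℝ} (hp : 1 ≤ p) (ht0 : 0 ≤ t) (ht1 : t < 1) {lam : ℂ}
    (h0 : lam ≠ 0) (hlam : ∀ m : ℕ, lam ≠ 1 / ((m : ℂ) + 1)) :
    ∃ C : ℝ, 0 ≤ C ∧ ∀ (g : ℂ → ℂ) (A : ℝ), HpBound p g A →
      ∃ f, HpBound p f (C * A) ∧ EqOn (fun z => lam * f z - cesaro t f z) g (ball 0 1) := by
  set a := lam⁻¹ with ha
  have hla : lam * a = 1 := mul_inv_cancel₀ h0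
  have hb : ∀ m : ℕ, 1 - a ≠ -(m : ℂ) := fun m hm => hlam m <| by
    rw [eq_div_iff (Nat.cast_add_one_ne_zero m)]
    linear_combination lam * hm + hla
  obtain ⟨C₁, hC₁, h₁⟩ := exists_hpBound_one_sub_cpow_mul hp ht0 ht1 (a - 1)
  obtain ⟨C₂, hC₂, h₂⟩ := exists_hpBound_euler_solution hp hb
  obtain ⟨C₃, hC₃, h₃⟩ := exists_hpBound_one_sub_cpow_mul hp ht0 ht1 (-a)
  refine ⟨‖a‖ ^ p * (2 ^ (p - 1) * (1 + ‖a‖ ^ p * (C₃ * (C₂ * C₁)))), by positivity,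
    fun g A hg => ?_⟩
  obtain ⟨u, hu, hueq⟩ := h₂ _ _ (h₁ g A hg)
  set K : ℂ → ℂ := fun z => a * ((1 - (t : ℂ) * z) ^ (-a) * u z) with hKdef
  have hK := (h₃ u _ hu).const_mul hp a
  have hf := (hg.add hp hK).const_mul hp a
  have hces : EqOn (cesaro t fun z => a * (g z + K z)) K (ball 0 1) := by
    refine cesaro_eqOn_of_equation ht0 ht1 hf.1 hK.1 fun z hz => ?_
    have hz0 := one_sub_mul_ne_zero ht0 ht1 hz
    have hd : HasDerivAt K _ z :=
      (((hasDerivAt_one_sub_cpow ht0 ht1 (-a) (ball_subset_closedBall hz)).mul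
        (hu.1.differentiableAt (isOpen_ball.mem_nhds hz)).hasDerivAt).const_mul a)
    have h := hueq z hz
    rw [cpow_sub _ _ hz0, cpow_one] at h
    have hw : (1 - (t : ℂ) * z) ^ a ≠ 0 := fun h => hz0 (cpow_eq_zero_iff _ _ |>.1 h).1
    rw [hd.deriv]
    simp only [hKdef, cpow_neg]
    generalize (1 - (t : ℂ) * z) ^ a = w at h hw ⊢
    obtain ⟨d, hd'⟩ : ∃ d, d = 1 - (t : ℂ) * z := ⟨_, rfl⟩
    rw [← hd'] at h hz0 ⊢
    clear_value a
    field_simp at h ⊢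
    linear_combination a * h + a ^ 2 * u z * hd'
  refine ⟨fun z => a * (g z + K z), hf.mono (le_of_eq (by ring)), fun z hz => ?_⟩
  simp only [hces hz]
  linear_combination (g z + K z) * hla

lemma exists_cesaro_eigenvector {p t : ℝ} (hp : 1 ≤ p) (ht0 : 0 ≤ t) (ht1 : t < 1) (m : ℕ) :
    ∃ f, MemHp p f ∧ (∃ z ∈ ball (0:ℂ) 1, f z ≠ 0) ∧
      EqOn (cesaro t f) (fun z => 1 / ((m : ℂ) + 1) * f z) (ball 0 1) := by
  obtain ⟨M, hM0, hM⟩ := exists_norm_one_sub_cpow_le ht0 ht1 (-((m : ℂ) + 1))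
  set f : ℂ → ℂ := fun z => z ^ m * (1 - (t : ℂ) * z) ^ (-((m : ℂ) + 1)) with hfdef
  have hf : DifferentiableOn ℂ f (ball 0 1) :=
    (differentiableOn_pow m).mul (differentiableOn_one_sub_cpow ht0 ht1 _)
  refine ⟨f, (hpBound_of_norm_le hp hf (M := M) fun z hz => ?_).memHp hp,
    ⟨1 / 2, by norm_num, ?_⟩, cesaro_eqOn_of_equation ht0 ht1 hf (hf.const_mul _)
      fun z hz => ?_⟩
  · rw [hfdef, norm_mul, norm_pow]
    exact (mul_le_of_le_one_left (norm_nonneg _)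
      (pow_le_one₀ (norm_nonneg _) (mem_ball_zero_iff.1 hz).le)).trans (hM z hz)
  · exact mul_ne_zero (pow_ne_zero _ (by norm_num)) fun h =>
      one_sub_mul_ne_zero ht0 ht1 (by norm_num) ((cpow_eq_zero_iff _ _).1 h).1
  · have hz0 := one_sub_mul_ne_zero ht0 ht1 hz
    have hm0 : (m : ℂ) + 1 ≠ 0 := Nat.cast_add_one_ne_zero m
    have h2 : z * (m * z ^ (m - 1)) = m * z ^ m := by
      cases m with
      | zero => simp
      | succ k => simp only [Nat.add_sub_cancel]; ring
    have hd : HasDerivAt (fun z => 1 / ((m : ℂ) + 1) * f z) _ z :=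
      ((hasDerivAt_pow m z).fun_mul (hasDerivAt_one_sub_cpow ht0 ht1 (-((m : ℂ) + 1))
        (ball_subset_closedBall hz))).const_mul (1 / ((m : ℂ) + 1))
    rw [hd.deriv]
    simp only [hfdef]
    generalize (1 - (t : ℂ) * z) ^ (-((m : ℂ) + 1)) = w
    generalize (m : ℂ) * z ^ (m - 1) = q at h2 ⊢
    obtain ⟨d, hd'⟩ : ∃ d, d = 1 - (t : ℂ) * z := ⟨_, rfl⟩
    rw [← hd'] at hz0 ⊢
    field_simp
    linear_combination w * d * h2 + w * z ^ m * (m + 1) * hd'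

lemma hardyNorm_le_of_norm_le {p : ℝ} (hp : 1 ≤ p) {f : ℂ → ℂ} {M : ℝ}
    (hf : DifferentiableOn ℂ f (ball (0:ℂ) 1)) (hM : 0 ≤ M)
    (hle : ∀ z ∈ ball (0:ℂ) 1, ‖f z‖ ≤ M) : hardyNorm p f ≤ M := by
  refine ((hpBound_of_norm_le hp hf hle).hardyNorm_le hp).trans_eq ?_
  rw [← mul_assoc, one_div_mul_cancel (by positivity), one_mul, one_div,
    Real.rpow_rpow_inv hM (by linarith)]

lemma hardyNorm_pos {p : ℝ} (hp : 1 ≤ p) {f : ℂ → ℂ} (hf : MemHp p f)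
    (hne : ∃ z ∈ ball (0:ℂ) 1, f z ≠ 0) : 0 < hardyNorm p f := by
  refine (hardyNorm_nonneg p f).lt_of_ne' fun h0 => ?_
  obtain ⟨z, hz, hz'⟩ := hne
  obtain ⟨C, _, hC⟩ := exists_norm_rpow_le hp (norm_nonneg z) (mem_ball_zero_iff.1 hz)
  have h1 := hC f _ (hf.hpBound hp) z le_rfl
  rw [h0, Real.zero_rpow (by linarith), mul_zero, mul_zero] at h1
  exact absurd h1 (not_le.2 (Real.rpow_pos_of_pos (norm_pos_iff.2 hz') p))

lemma half_le_hardyNorm_pow {p : ℝ} (hp : 1 ≤ p) {n : ℕ} (hn : n ≠ 0)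
    (hmem : MemHp p fun z => z ^ n) : 1 / 2 ≤ hardyNorm p fun z => z ^ n := by
  set r : ℝ := (1 / 2) ^ (n⁻¹ : ℝ) with hr
  have hr0 : 0 ≤ r := by positivity
  have hrn : r ^ n = 1 / 2 := Real.rpow_inv_natCast_pow (by norm_num) hn
  have hr1 : r < 1 := Real.rpow_lt_one (by norm_num) (by norm_num) (by positivity)
  refine le_trans (le_of_eq ?_) (le_csSup hmem.2 ⟨r, ⟨hr0, hr1⟩, rfl⟩)
  simp only [Mp, norm_pow, norm_mul, norm_real, norm_exp_ofReal_mul_I, mul_one, Real.norm_eq_abs,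
    abs_of_nonneg hr0, hrn, intervalIntegral.integral_const, sub_zero, smul_eq_mul]
  rw [← mul_assoc, one_div_mul_cancel (by positivity), one_mul, one_div p,
    Real.rpow_rpow_inv (by norm_num) (by linarith)]

lemma norm_cesaro_pow_le {t M : ℝ} (ht0 : 0 ≤ t) (ht1 : t < 1)
    (hM : ∀ z ∈ ball (0:ℂ) 1, ‖(1 - (t : ℂ) * z) ^ (-1 : ℂ)‖ ≤ M) (n : ℕ) {z : ℂ}
    (hz : z ∈ ball (0:ℂ) 1) : ‖cesaro t (fun z => z ^ n) z‖ ≤ M / (n + 1) := by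
  rw [cesaro_eq_eulerIntegral]
  have hc := (differentiableOn_div_one_sub ht0 ht1 (differentiableOn_pow n)).continuousOn
  refine (norm_eulerIntegral_le (by simp) hc hz).trans ?_
  calc _ ≤ ∫ s in (0:ℝ)..1, s ^ n * M := by
        refine intervalIntegral.integral_mono_on zero_le_one
          ((continuousOn_comp_ofReal_mul hc hz).norm.intervalIntegrable_of_Icc zero_le_one)
          ((by fun_prop : Continuous fun s : ℝ => s ^ n * M).intervalIntegrable _ _) fun s hs => ?_
        have h1 := hM _ (smul_mem_unitBall hs hz)
        rw [cpow_neg_one] at h1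
        rw [div_eq_mul_inv, norm_mul, norm_pow, norm_mul, norm_real, Real.norm_eq_abs,
          abs_of_nonneg hs.1]
        have h2 : s * ‖z‖ ≤ s := mul_le_of_le_one_right hs.1 (mem_ball_zero_iff.1 hz).le
        have := hs.1
        gcongr
    _ = M / (n + 1) := by
        rw [intervalIntegral.integral_mul_const, integral_pow]
        simp
        ring

lemma not_isResolventPt_zero {p t : ℝ} (hp : 1 ≤ p) (ht0 : 0 ≤ t) (ht1 : t < 1) :
    ¬ IsResolventPt (MemHp p) (hardyNorm p) (cesaro t) 0 := by
  rintro ⟨_, _, C, hC⟩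
  obtain ⟨M, hM0, hM⟩ := exists_norm_one_sub_cpow_le ht0 ht1 (-1)
  obtain ⟨n, hn⟩ := exists_nat_gt (2 * (|C| * M))
  have hd : DifferentiableOn ℂ (fun z : ℂ => z ^ (n + 1)) (ball 0 1) := differentiableOn_pow _
  have hmem : MemHp p fun z => z ^ (n + 1) :=
    (hpBound_of_norm_le hp hd (M := 1) fun z hz => by
      rw [norm_pow]
      exact pow_le_one₀ (norm_nonneg _) (mem_ball_zero_iff.1 hz).le).memHp hp
  have hT := hardyNorm_le_of_norm_le hp (f := fun z => 0 * z ^ (n + 1) -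
      cesaro t (fun z => z ^ (n + 1)) z) (M := M / ((n + 1 : ℕ) + 1))
    ((hd.const_mul 0).sub (differentiableOn_cesaro ht0 ht1 hd)) (by positivity) fun z hz => by
      simpa using norm_cesaro_pow_le ht0 ht1 hM (n + 1) hz
  have h1 := (half_le_hardyNorm_pow hp n.succ_ne_zero hmem).trans (hC _ hmem)
  have h2 : 1 / 2 ≤ |C| * (M / ((n + 1 : ℕ) + 1)) :=
    h1.trans ((mul_le_mul_of_nonneg_right (le_abs_self C) (hardyNorm_nonneg _ _)).trans
      (mul_le_mul_of_nonneg_left hT (abs_nonneg C)))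
  rw [← mul_div_assoc, le_div_iff₀ (by positivity)] at h2
  push_cast at h2
  linarith

lemma not_isResolventPt_of_eigenvector {p t : ℝ} (hp : 1 ≤ p) {lam : ℂ} {f : ℂ → ℂ}
    (hf : MemHp p f) (hne : ∃ z ∈ ball (0:ℂ) 1, f z ≠ 0)
    (heq : EqOn (cesaro t f) (fun z => lam * f z) (ball 0 1)) :
    ¬ IsResolventPt (MemHp p) (hardyNorm p) (cesaro t) lam := by
  rintro ⟨_, _, C, hC⟩
  have h0 : hardyNorm p (fun z => lam * f z - cesaro t f z) ≤ 0 := by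
    rw [hardyNorm_congr (g := fun _ => 0) fun z hz => sub_eq_zero.2 (heq hz).symm]
    exact hardyNorm_le_of_norm_le hp (differentiableOn_const _) le_rfl fun _ _ => by simp
  have h1 := hC f hf
  rw [h0.antisymm (hardyNorm_nonneg _ _), mul_zero] at h1
  exact (hardyNorm_pos hp hf hne).not_ge h1

lemma isResolventPt_of_ne {p t : ℝ} (hp : 1 ≤ p) (ht0 : 0 ≤ t) (ht1 : t < 1) {lam : ℂ}
    (h0 : lam ≠ 0) (hlam : ∀ m : ℕ, lam ≠ 1 / ((m : ℂ) + 1)) :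
    IsResolventPt (MemHp p) (hardyNorm p) (cesaro t) lam := by
  obtain ⟨C, hC0, hC⟩ := exists_hpBound_resolvent hp ht0 ht1 h0 hlam
  have hmaps : ∀ f, MemHp p f → MemHp p fun z => lam * f z - cesaro t f z := fun f hf => by
    obtain ⟨C', _, hC'⟩ := exists_hpBound_cesaro hp ht0 ht1
    have h := hf.hpBound hp
    simpa [sub_eq_add_neg] using
      ((h.const_mul hp lam).add hp ((hC' f _ h).const_mul hp (-1))).memHp hp
  refine ⟨hmaps, fun g hg => ?_, (C ^ (1 / p)), fun f hf => ?_⟩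
  · obtain ⟨f, hf, hfg⟩ := hC g _ (hg.hpBound hp)
    exact ⟨f, hf.memHp hp, hfg⟩
  · set g := fun z => lam * f z - cesaro t f z with hg
    obtain ⟨f', hf', hfg⟩ := hC g _ ((hmaps f hf).hpBound hp)
    have hff' : EqOn f f' (ball 0 1) := by
      by_contra hne
      simp only [EqOn, not_forall, exists_prop] at hne
      obtain ⟨m, hm⟩ := eq_one_div_of_cesaro_eigenvector (f := fun z => f z - f' z) (lam := lam)
        ht0 ht1 (hf.1.sub hf'.1) (by simpa [sub_eq_zero] using hne) fun z hz => by
          have h1 := hfg hz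
          rw [cesaro_sub ht0 ht1 hf.1 hf'.1 hz]
          simp only [hg] at h1 ⊢
          linear_combination h1
      exact hlam m hm
    have hN := hardyNorm_nonneg p g
    rw [hardyNorm_congr hff']
    refine (hf'.hardyNorm_le hp).trans_eq ?_
    rw [show 1 / (2 * Real.pi) * (C * (2 * Real.pi * hardyNorm p g ^ p))
      = C * hardyNorm p g ^ p by field_simp, Real.mul_rpow hC0 (by positivity), one_div,
      Real.rpow_rpow_inv hN (by linarith)]

/-- For `1 ≤ p < ∞` and `t ∈ [0,1)`, the point spectrum of `C_t` on `H^p` equals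
`{1/(m+1) : m ∈ ℕ₀}` and the spectrum of `C_t` on `H^p` equals
`{1/(m+1) : m ∈ ℕ₀} ∪ {0}`. -/
theorem cesaro_spectrum_Hp (p t : ℝ) (hp : 1 ≤ p) (ht0 : 0 ≤ t) (ht1 : t < 1) (lam : ℂ) :
    ((∃ f, MemHp p f ∧ (∃ z ∈ Metric.ball (0:ℂ) 1, f z ≠ 0) ∧
        Set.EqOn (cesaro t f) (fun z => lam * f z) (Metric.ball (0:ℂ) 1)) ↔
      (∃ m : ℕ, lam = 1 / ((m : ℂ) + 1))) ∧
    ((¬ IsResolventPt (MemHp p) (hardyNorm p) (cesaro t) lam) ↔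
      (lam = 0 ∨ ∃ m : ℕ, lam = 1 / ((m : ℂ) + 1))) := by
  refine ⟨⟨fun ⟨f, hf, hne, heq⟩ => eq_one_div_of_cesaro_eigenvector ht0 ht1 hf.1 hne heq, ?_⟩,
    fun h => ?_, ?_⟩
  · rintro ⟨m, rfl⟩
    exact exists_cesaro_eigenvector hp ht0 ht1 m
  · by_contra! hlam
    exact h (isResolventPt_of_ne hp ht0 ht1 hlam.1 hlam.2)
  · rintro (rfl | ⟨m, rfl⟩)
    · exact not_isResolventPt_zero hp ht0 ht1
    · obtain ⟨f, hf, hne, heq⟩ := exists_cesaro_eigenvector hp ht0 ht1 m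
      exact not_isResolventPt_of_eigenvector hp hf hne heq
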